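/- In the n-spin Hamming-weight setting, fix θ ∈ ℝ with sin θ ≠ 1 and sin θ ≠ −1, and let H_θ := (Σ_i S_i^{s^x})·cos θ + (Σ_i S_i^{s^z})·sin θ act on ℂ^X. Then for each integer k with 0 ≤ k ≤ n, the eigenspace of H_θ for the eigenvalue (1/2)·(n(cos θ + sin θ) + (2k − n)) has dimension exactly the binomial coefficient C(n, k). In particular, taking k = 0, the ground level is nondegenerate. -/

import Mathlib

/-- `s^x = (1/2)(I − σ^x)` as a complex matrix. -/
noncomputable def sxC : Matrix (Fin 2) (Fin 2) ℂ := !![1/2, -1/2; -1/2, 1/2]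

/-- `s^z = (1/2)(I − σ^z)` as a complex matrix. -/
noncomputable def szC : Matrix (Fin 2) (Fin 2) ℂ := !![0, 0; 0, 1]

/-- The operator `S_i^A` acting as `A` on site `i` and as the identity elsewhere. -/
noncomputable def siteOp (n : ℕ) (A : Matrix (Fin 2) (Fin 2) ℂ) (i : Fin n) :
    Matrix (Fin n → Fin 2) (Fin n → Fin 2) ℂ := fun x y =>
  A (x i) (y i) * ∏ j ∈ Finset.univ.filter (fun j => j ≠ i), (if x j = y j then (1:ℂ) else 0)

noncomputable def tens (n : ℕ) (M : Fin n → Matrix (Fin 2) (Fin 2) ℂ) :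
    Matrix (Fin n → Fin 2) (Fin n → Fin 2) ℂ := fun x y => ∏ j, M j (x j) (y j)

lemma tens_mul (n : ℕ) (M N : Fin n → Matrix (Fin 2) (Fin 2) ℂ) :
    tens n M * tens n N = tens n (fun j => M j * N j) := by
  ext x y
  simp only [tens, Matrix.mul_apply]
  rw [Finset.prod_univ_sum]
  simp [Finset.prod_mul_distrib]

lemma tens_one (n : ℕ) : tens n (fun _ => 1) = 1 := by
  ext x y
  simp only [tens, Matrix.one_apply]
  by_cases h : x = y
  · simp [h]
  · rw [if_neg h]
    obtain ⟨j, hj⟩ := Function.ne_iff.mp h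
    exact Finset.prod_eq_zero (Finset.mem_univ j) (if_neg hj)

lemma siteOp_eq_tens (n : ℕ) (A : Matrix (Fin 2) (Fin 2) ℂ) (i : Fin n) :
    siteOp n A i = tens n (fun j => if j = i then A else 1) := by
  ext x y
  simp only [tens, siteOp]
  rw [← Finset.mul_prod_erase Finset.univ _ (Finset.mem_univ i), if_pos rfl]
  congr 1
  have : Finset.univ.filter (fun j => j ≠ i) = Finset.univ.erase i := by
    ext j; simp
  rw [this]
  refine Finset.prod_congr rfl fun j hj => ?_
  rw [if_neg (Finset.ne_of_mem_erase hj), Matrix.one_apply]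

lemma siteOp_comm (n : ℕ) (A P D : Matrix (Fin 2) (Fin 2) ℂ) (h : A * P = P * D) (i : Fin n) :
    siteOp n A i * tens n (fun _ => P) = tens n (fun _ => P) * siteOp n D i := by
  rw [siteOp_eq_tens, siteOp_eq_tens, tens_mul, tens_mul]
  congr 1
  funext j
  by_cases hj : j = i
  · simp [hj, h]
  · simp [hj]

lemma siteOp_diag (n : ℕ) (a : Fin 2 → ℂ) (i : Fin n) :
    siteOp n (Matrix.diagonal a) i = Matrix.diagonal (fun x => a (x i)) := by
  ext x y
  by_cases h : x = y
  · subst h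
    simp [siteOp]
  · rw [Matrix.diagonal_apply_ne _ h]
    obtain ⟨j, hj⟩ := Function.ne_iff.mp h
    by_cases hji : j = i
    · subst hji
      simp [siteOp, Matrix.diagonal_apply_ne _ hj]
    · rw [siteOp, Finset.prod_eq_zero (i := j) (by simpa using hji) (if_neg hj), mul_zero]

lemma count_choose (n k : ℕ) :
    Fintype.card {x : Fin n → Fin 2 // (Finset.univ.filter (fun i => x i = 1)).card = k}
      = n.choose k := by
  classical
  have e : {x : Fin n → Fin 2 // (Finset.univ.filter (fun i => x i = 1)).card = k} ≃
      {s : Finset (Fin n) // s.card = k} :=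
    { toFun := fun x => ⟨Finset.univ.filter (fun i => x.1 i = 1), x.2⟩
      invFun := fun s => ⟨fun i => if i ∈ s.1 then 1 else 0, by
        simpa using s.2⟩
      left_inv := by
        rintro ⟨x, hx⟩
        ext i
        simp only [Finset.mem_filter, Finset.mem_univ, true_and]
        split_ifs with h
        · simp [h]
        · have : x i = 0 := by omega
          simp [this]
      right_inv := by
        rintro ⟨s, hs⟩
        ext i
        simp }
  rw [Fintype.card_congr e]
  simp

lemma finrank_eig {X : Type*} [Fintype X] [DecidableEq X] (H P Q : Matrix X X ℂ) (d : X → ℂ)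
    (μ : ℂ) (hPQ : P * Q = 1) (hH : H * P = P * Matrix.diagonal d) :
    Module.finrank ℂ (Module.End.eigenspace (Matrix.toLin' H) μ)
      = Fintype.card {x // d x = μ} := by
  classical
  have hdet : IsUnit P.det := (Matrix.isUnit_iff_isUnit_det P).mp
    (IsUnit.of_mul_eq_one Q hPQ)
  have hr : (H - Matrix.diagonal (fun _ => μ)).rank = Fintype.card {x // d x - μ ≠ 0} := by
    rw [← Matrix.rank_diagonal (fun x => d x - μ), 
      ← Matrix.rank_mul_eq_left_of_isUnit_det P _ hdet,
      ← Matrix.rank_mul_eq_right_of_isUnit_det P (Matrix.diagonal fun x => d x - μ) hdet]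
    congr 1
    rw [← Matrix.diagonal_sub, sub_mul, mul_sub, hH]
    congr 1
    ext x y
    simp [mul_comm]
  have hk : Module.End.eigenspace (Matrix.toLin' H) μ
      = LinearMap.ker (H - Matrix.diagonal (fun _ => μ)).mulVecLin := by
    ext v
    rw [Module.End.mem_eigenspace_iff, LinearMap.mem_ker, Matrix.mulVecLin_apply,
      Matrix.sub_mulVec, sub_eq_zero, Matrix.toLin'_apply]
    have : (Matrix.diagonal (fun _ => μ)).mulVec v = μ • v := by
      ext x; simp [Matrix.mulVec_diagonal]
    rw [this]
  have := LinearMap.finrank_range_add_finrank_ker (H - Matrix.diagonal (fun _ => μ)).mulVecLin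
  rw [← hk] at this
  change (H - Matrix.diagonal (fun _ => μ)).rank + _ = _ at this
  rw [hr, Module.finrank_fintype_fun_eq_card] at this
  have h3 := Fintype.card_subtype_compl (fun x => d x = μ)
  have h4 := Fintype.card_subtype_le (fun x => d x = μ)
  have h5 : Fintype.card {x // d x - μ ≠ 0} = Fintype.card {x // ¬ d x = μ} :=
    Fintype.card_congr (Equiv.subtypeEquivRight fun x => by rw [ne_eq, sub_eq_zero])
  omega

/-- Along the Hamming-weight adiabatic path (with `sin θ ≠ ±1`), the eigenvalue
`(1/2)(n(cos θ + sin θ) + (2k − n))` of `H_θ` has eigenspace of dimension exactly the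
binomial coefficient `C(n, k)`; in particular, for `k = 0` the ground level is
nondegenerate. -/
theorem hamming_weight_degeneracy (n k : ℕ) (hk : k ≤ n) (θ : ℝ)
    (h1 : Real.sin θ ≠ 1) (h2 : Real.sin θ ≠ -1) :
    Module.finrank ℂ
        (Module.End.eigenspace
          (Matrix.toLin'
            ((Real.cos θ : ℂ) • (∑ i, siteOp n sxC i) +
              (Real.sin θ : ℂ) • (∑ i, siteOp n szC i)))
          (((1 / 2 * ((n : ℝ) * (Real.cos θ + Real.sin θ) + (2 * (k : ℝ) - (n : ℝ))) : ℝ)) : ℂ))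
      = n.choose k := by
  have hsc : (Real.sin θ : ℂ) ^ 2 + (Real.cos θ : ℂ) ^ 2 = 1 := by
    exact_mod_cast Real.sin_sq_add_cos_sq θ
  have hc : (Real.cos θ : ℂ) ≠ 0 := by
    intro h
    have h0 : Real.cos θ = 0 := by exact_mod_cast h
    have h3 := Real.sin_sq_add_cos_sq θ
    rw [h0] at h3
    have : (Real.sin θ - 1) * (Real.sin θ + 1) = 0 := by linarith
    rcases mul_eq_zero.mp this with h | h
    · exact h1 (by linarith)
    · exact h2 (by linarith)
  have hμ : (((1 / 2 * ((n : ℝ) * (Real.cos θ + Real.sin θ) + (2 * (k : ℝ) - (n : ℝ))) : ℝ)) : ℂ)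
      = 1 / 2 * ((n : ℂ) * ((Real.cos θ : ℂ) + (Real.sin θ : ℂ)) + (2 * (k : ℂ) - (n : ℂ))) := by
    push_cast
    ring
  rw [hμ]
  clear hμ
  generalize (Real.sin θ : ℂ) = s at *
  generalize (Real.cos θ : ℂ) = c at *
  let P : Matrix (Fin 2) (Fin 2) ℂ := !![c, c; 1 - s, -1 - s]
  let a : Fin 2 → ℂ := ![(c + s - 1) / 2, (c + s + 1) / 2]
  have hA : (c • sxC + s • szC) * P = P * Matrix.diagonal a := by
    ext i j
    fin_cases i <;> fin_cases j <;>
      simp [sxC, szC, P, a, Matrix.mul_apply, Fin.sum_univ_two, Matrix.diagonal] <;>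
      first | ring1 | linear_combination (1 / 2 : ℂ) * hsc | linear_combination (-1 / 2 : ℂ) * hsc
  have hP : P * P⁻¹ = 1 := by
    apply Matrix.mul_nonsing_inv
    rw [isUnit_iff_ne_zero, Matrix.det_fin_two_of]
    intro h
    apply hc
    linear_combination (-1 / 2 : ℂ) * h
  have hsum : c • (∑ i, siteOp n sxC i) + s • (∑ i, siteOp n szC i)
      = ∑ i, siteOp n (c • sxC + s • szC) i := by
    rw [Finset.smul_sum, Finset.smul_sum, ← Finset.sum_add_distrib]
    refine Finset.sum_congr rfl fun i _ => ?_
    ext x y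
    simp [siteOp]
    ring
  have hmain : (∑ i, siteOp n (c • sxC + s • szC) i) * tens n (fun _ => P)
      = tens n (fun _ => P) * Matrix.diagonal (fun x => ∑ i, a (x i)) := by
    have : Matrix.diagonal (fun x : Fin n → Fin 2 => ∑ i, a (x i))
        = ∑ i, siteOp n (Matrix.diagonal a) i := by
      simp only [siteOp_diag]
      ext x y
      by_cases h : x = y
      · subst h; simp [Matrix.sum_apply]
      · simp [Matrix.sum_apply, h]
    rw [this, Finset.sum_mul, Finset.mul_sum]
    exact Finset.sum_congr rfl fun i _ => siteOp_comm n _ _ _ hA i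
  rw [hsum, finrank_eig _ _ (tens n (fun _ => P⁻¹)) _ _ (by rw [tens_mul, hP, tens_one]) hmain,
    ← count_choose n k]
  refine Fintype.card_congr (Equiv.subtypeEquivRight fun x => ?_)
  have hx : ∑ i, a (x i) = n * ((c + s - 1) / 2)
      + ((Finset.univ.filter (fun i => x i = 1)).card : ℂ) := by
    have : ∀ i, a (x i) = (c + s - 1) / 2 + if x i = 1 then 1 else 0 := by
      intro i
      generalize x i = t
      fin_cases t
      · simp [a]
      · simp [a]; ring
    simp [this, Finset.sum_add_distrib]
  rw [hx]
  constructor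
  · intro h
    have : ((Finset.univ.filter (fun i => x i = 1)).card : ℂ) = k := by linear_combination h
    exact_mod_cast this
  · intro h
    rw [h]; ring
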